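/- arXiv:2401.01957 — 3 statements merged into one kernel-verified Lean document; each statement's English description precedes it below -/
import Mathlib

section
/- The map t ↦ Φ_t^{132} is a bijection from the set 𝔗_{n+1} of rooted ordered trees with n+1 vertices to the set Av_n(132) of permutations of [n] avoiding 132, where for t ∈ 𝔗_{n+1} with vertices v_0, v_1, …, v_n listed in increasing lexicographic order and w_i = v_{n+1−i}, Φ_t^{132}(i) = |t| − i + |t_{w_i}| − |w_i| for i = 1, …, n, with |t| = n+1 the number of vertices of t, t_{w_i} the fringe subtree of t at w_i, and |w_i| the height of w_i. -/
open Set Filter MeasureTheory Topology TopologicalSpace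
open scoped ENNReal

namespace AvoidPaper

/-- Instances for the codomain `ℕ∞` (one-point compactification of `ℕ`). -/
instance : SecondCountableTopology ℕ∞ := by
  have h : ({s : Set ℕ∞ | ∃ a, s = Set.Ioi a ∨ s = Set.Iio a}).Countable := by
    have hsub : {s : Set ℕ∞ | ∃ a, s = Set.Ioi a ∨ s = Set.Iio a}
        ⊆ Set.range (Set.Ioi : ℕ∞ → Set ℕ∞) ∪ Set.range (Set.Iio : ℕ∞ → Set ℕ∞) := by
      rintro s ⟨a, rfl | rfl⟩
      · exact Or.inl ⟨a, rfl⟩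
      · exact Or.inr ⟨a, rfl⟩
    exact ((Set.countable_range _).union (Set.countable_range _)).mono hsub
  exact SecondCountableTopology.mk' h

instance : OpensMeasurableSpace ℕ∞ := ⟨le_top⟩

/-! ## Ulam–Harris vertices and rooted ordered trees -/

/-- A vertex of the Ulam–Harris tree: a finite list of natural numbers (children indices),
ordered lexicographically (so an ancestor precedes its descendants). -/
abbrev Vertex : Type := List ℕ

/-- A (rooted ordered) tree: contains the root, is closed under ancestors, and is
left-closed among siblings. -/
def IsTree (t : Set Vertex) : Prop :=
  ([] : Vertex) ∈ t ∧ (∀ u v : Vertex, u ++ v ∈ t → u ∈ t) ∧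
    ∀ (u : Vertex) (i j : ℕ), u ++ [i] ∈ t → j ≤ i → u ++ [j] ∈ t

/-- The set of children indices of `u` in `t`. -/
def children (t : Set Vertex) (u : Vertex) : Set ℕ := {i | u ++ [i] ∈ t}

/-- Locally finite tree. -/
def LocFin (t : Set Vertex) : Prop := ∀ u : Vertex, (children t u).Finite

/-- Number of children of `u` in `t`. -/
noncomputable def childCount (t : Set Vertex) (u : Vertex) : ℕ := (children t u).ncard

/-- The degree function `d_t(u)`: number of children, and `-1` if `u ∉ t`. -/
noncomputable def deg (t : Set Vertex) (u : Vertex) : ℤ :=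
  haveI := Classical.dec (u ∈ t)
  if u ∈ t then (childCount t u : ℤ) else -1

/-- `t^[m]`: restriction of `t` to the vertices of height at most `m`. -/
def trunc (t : Set Vertex) (m : ℕ) : Set Vertex := {u ∈ t | u.length ≤ m}

/-- Local convergence of trees: `d_{t_n}(u) → d_t(u)` for every vertex `u`
(equivalently, eventual equality, since degrees are integers). -/
def LocalConv (ts : ℕ → Set Vertex) (t : Set Vertex) : Prop :=
  ∀ u : Vertex, ∀ᶠ n in atTop, deg (ts n) u = deg t u

/-- A leaf: a vertex of `t` with no children. -/
def IsLeaf (t : Set Vertex) (v : Vertex) : Prop := v ∈ t ∧ ∀ i : ℕ, v ++ [i] ∉ t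

def leafSet (t : Set Vertex) : Set Vertex := {v | IsLeaf t v}

/-- The fringe subtree `t_v` of `t` at `v` (as a subset of `t`). -/
def fringe (t : Set Vertex) (v : Vertex) : Set Vertex := {x ∈ t | v <+: x}

/-- Number of vertices of `t` at height exactly `k`. -/
noncomputable def levelCount (t : Set Vertex) (k : ℕ) : ℕ := {u ∈ t | u.length = k}.ncard

/-- An infinite spine of `t`: `η 0` is the root and `η (i+1)` is a child of `η i`. -/
def IsSpine (t : Set Vertex) (η : ℕ → Vertex) : Prop :=
  η 0 = [] ∧ (∀ i, η i ∈ t) ∧ ∀ i, ∃ c : ℕ, η (i + 1) = η i ++ [c]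

/-- `v` lies strictly to the left of the spine `η`. -/
def LeftOfSpine (t : Set Vertex) (η : ℕ → Vertex) (v : Vertex) : Prop :=
  v ∈ t ∧ (∀ i, η i ≠ v) ∧ ∃ j, v < η j

/-- `v` lies strictly to the right of the spine `η`. -/
def RightOfSpine (t : Set Vertex) (η : ℕ → Vertex) (v : Vertex) : Prop :=
  v ∈ t ∧ ∀ j, η j < v

/-- `η` is the unique infinite spine of `t`, with infinitely many subtrees attached to
the left and to the right of the spine, infinitely many of the left ones having at
least two vertices. -/
def SpineSpec (t : Set Vertex) (η : ℕ → Vertex) : Prop :=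
  IsSpine t η ∧ (∀ η', IsSpine t η' → η' = η) ∧
  {u : Vertex | (∃ k c, u = η k ++ [c]) ∧ LeftOfSpine t η u}.Infinite ∧
  {u : Vertex | (∃ k c, u = η k ++ [c]) ∧ RightOfSpine t η u}.Infinite ∧
  {u : Vertex | (∃ k c, u = η k ++ [c]) ∧ LeftOfSpine t η u ∧
      2 ≤ (fringe t u).encard}.Infinite

/-- `𝔗_f`: finite trees with at least two vertices. -/
def MemTf (t : Set Vertex) : Prop := IsTree t ∧ t.Finite ∧ 2 ≤ t.encard

/-- `𝔗_∞`. -/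
def MemTinf (t : Set Vertex) : Prop :=
  IsTree t ∧ LocFin t ∧ t.Infinite ∧ ∃ η : ℕ → Vertex, SpineSpec t η

/-- The leaves of `t` lying to the left of the spine `η`. -/
def leftLeaves (t : Set Vertex) (η : ℕ → Vertex) : Set Vertex :=
  {x | IsLeaf t x ∧ LeftOfSpine t η x}

/-- `v` is the enumeration `(v_{t,i})` of (an initial part of) `t` in increasing
lexicographic order: `v i ∈ t` and the vertices of `t` smaller than `v i` are
exactly `v 0, …, v (i-1)`. -/
def IsLexEnum (t : Set Vertex) (v : ℕ → Vertex) : Prop :=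
  ∀ i : ℕ, (i : ℕ∞) < t.encard →
    v i ∈ t ∧ {x ∈ t | x < v i} = v '' {j | j < i}

/-- `w` is the enumeration `(w_{t,i})` of (a final part of) `t` in decreasing
lexicographic order, starting from the lexicographically largest vertex. -/
def IsLexCoEnum (t : Set Vertex) (w : ℕ → Vertex) : Prop :=
  ∀ i : ℕ, (i : ℕ∞) < t.encard →
    w i ∈ t ∧ {x ∈ t | w i < x} = w '' {j | j < i}

/-- `l` enumerates the set `A` in increasing lexicographic order. -/
def IsEnumOf (A : Set Vertex) (l : ℕ → Vertex) : Prop :=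
  ∀ i : ℕ, (i : ℕ∞) < A.encard →
    l i ∈ A ∧ {x ∈ A | x < l i} = l '' {j | j < i}

/-- `s_i`: the number of vertices of `t` lexicographically smaller than the `i`-th leaf
(0-indexed: `l 0` is the paper's `l_1`). -/
noncomputable def sVal (t : Set Vertex) (l : ℕ → Vertex) (i : ℕ) : ℕ :=
  {x ∈ t | x < l i}.ncard

/-- `p_i`: the height of the `i`-th leaf. -/
def pVal (l : ℕ → Vertex) (i : ℕ) : ℕ := (l i).length

/-! ## The maps Φ^σ -/

/-- `Φ^{231}` as an element of `F(ℕ, ℕ*)` (value `i` outside the range of indices). -/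
noncomputable def phi231 (t : Set Vertex) (v : ℕ → Vertex) : ℕ → ℕ∞ := fun i =>
  if 1 ≤ i ∧ (i : ℕ∞) < t.encard then
    ((i : ℕ∞) + (fringe t (v i)).encard) - ((v i).length : ℕ∞)
  else (i : ℕ∞)

noncomputable def phi213 (t : Set Vertex) (v : ℕ → Vertex) : ℕ → ℕ∞ := fun i =>
  if 1 ≤ i ∧ (i : ℕ∞) < t.encard then
    ((t \ fringe t (v i)).encard + ((v i).length : ℕ∞)) - (i : ℕ∞)
  else (i : ℕ∞)

noncomputable def phi312 (t : Set Vertex) (w : ℕ → Vertex) : ℕ → ℕ∞ := fun i =>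
  if 1 ≤ i ∧ (i : ℕ∞) < t.encard then
    ((i : ℕ∞) + ((w (i - 1)).length : ℕ∞)) - (fringe t (w (i - 1))).encard
  else (i : ℕ∞)

noncomputable def phi132 (t : Set Vertex) (w : ℕ → Vertex) : ℕ → ℕ∞ := fun i =>
  if 1 ≤ i ∧ (i : ℕ∞) < t.encard then
    ((t.encard + (fringe t (w (i - 1))).encard) - (i : ℕ∞)) - ((w (i - 1)).length : ℕ∞)
  else (i : ℕ∞)

/-- `B = {s_i - p_i + 1 : i}` (with `i` ranging over indices `< L` of leaves). -/
def Bset (S P : ℕ → ℕ) (L : ℕ∞) : Set ℕ :=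
  {b | ∃ i : ℕ, (i : ℕ∞) < L ∧ S i - P i + 1 = b}

/-- `A = {s_i : i}`. -/
def Aset (S : ℕ → ℕ) (L : ℕ∞) : Set ℕ := {a | ∃ i : ℕ, (i : ℕ∞) < L ∧ S i = a}

/-- The number of elements of `C` in `{1, …, j}`. -/
noncomputable def rankIn (C : Set ℕ) (j : ℕ) : ℕ := (C ∩ Set.Icc 1 j).ncard

/-- The `a`-th smallest positive element of `C`. -/
noncomputable def nthOf (C : Set ℕ) (a : ℕ) : ℕ :=
  sInf {m : ℕ | a ≤ (C ∩ Set.Icc 1 m).ncard}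

open Classical in
/-- `Φ^{321}` built from the data `s, p` (and the number `L` of leaves):
`s_i - p_i + 1 ↦ s_i`, extended by the unique increasing bijection between the
complements (and by the identity outside `[1, n]` in the finite case). -/
noncomputable def phi321Fun (S P : ℕ → ℕ) (L : ℕ∞) : ℕ → ℕ∞ := fun j =>
  if h : j ∈ Bset S P L then (S h.choose : ℕ∞)
  else (nthOf (Aset S L)ᶜ (rankIn (Bset S P L)ᶜ j) : ℕ∞)

/-- `Φ^{123} = |t| + 1 - Φ^{321}` as an element of `F(ℕ, ℕ*)`. -/
noncomputable def phi123Fun (tc : ℕ∞) (f : ℕ → ℕ∞) : ℕ → ℕ∞ := fun j =>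
  if 1 ≤ j ∧ (j : ℕ∞) < tc then (tc + 1) - f j else (j : ℕ∞)

/-! ## Patterns and pattern avoidance -/

def p123 : Equiv.Perm (Fin 3) := Equiv.refl _
noncomputable def p321 : Equiv.Perm (Fin 3) := Equiv.ofBijective ![2, 1, 0] (by decide)
noncomputable def p231 : Equiv.Perm (Fin 3) := Equiv.ofBijective ![1, 2, 0] (by decide)
noncomputable def p213 : Equiv.Perm (Fin 3) := Equiv.ofBijective ![1, 0, 2] (by decide)
noncomputable def p312 : Equiv.Perm (Fin 3) := Equiv.ofBijective ![2, 0, 1] (by decide)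
noncomputable def p132 : Equiv.Perm (Fin 3) := Equiv.ofBijective ![0, 2, 1] (by decide)

/-- `π` contains the length-3 pattern `σ`. -/
def ContainsPat {n : ℕ} (π : Equiv.Perm (Fin n)) (σ : Equiv.Perm (Fin 3)) : Prop :=
  ∃ f : Fin 3 → Fin n, StrictMono f ∧ ∀ j k : Fin 3, σ j < σ k ↔ π (f j) < π (f k)

/-- `π` avoids the length-3 pattern `σ`. -/
def AvoidsPat {n : ℕ} (π : Equiv.Perm (Fin n)) (σ : Equiv.Perm (Fin 3)) : Prop :=
  ¬ ContainsPat π σ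

/-- Trees with `n+1` vertices. -/
def TreeN (n : ℕ) : Type := {t : Set Vertex // IsTree t ∧ t.encard = (n : ℕ∞) + 1}

/-- Embedding of a permutation of `[n]` into `F(ℕ, ℕ*)` by `π(k) = k` for `k > n`
(permutations are `1`-indexed: position `k ∈ [1, n]` corresponds to `k - 1 : Fin n`). -/
noncomputable def embedPerm {n : ℕ} (π : Equiv.Perm (Fin n)) : ℕ → ℕ∞ := fun k =>
  if h : 1 ≤ k ∧ k ≤ n then (((π ⟨k - 1, by omega⟩ : Fin n) : ℕ) + 1 : ℕ) else (k : ℕ∞)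

/-- The (finite) set of permutations of `[n]` avoiding `σ`. -/
noncomputable def avoidFinset (σ : Equiv.Perm (Fin 3)) (n : ℕ) : Finset (Equiv.Perm (Fin n)) :=
  Set.Finite.toFinset (Set.toFinite {π : Equiv.Perm (Fin n) | AvoidsPat π σ})

/-- The law of a uniformly random `σ`-avoiding permutation of `[n]`,
as a measure on `F(ℕ, ℕ*)`. -/
noncomputable def uniformAvoidLaw (σ : Equiv.Perm (Fin 3)) (n : ℕ) : Measure (ℕ → ℕ∞) :=
  ((avoidFinset σ n).card : ℝ≥0∞)⁻¹ • ∑ π ∈ avoidFinset σ n, Measure.dirac (embedPerm π)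


open Classical in
/-- `Φ^σ` for an arbitrary pattern `σ ∈ S_3`, given a tree together with its increasing
vertex enumeration `v`, its decreasing vertex enumeration `w`, and the increasing
enumeration `l` of the relevant set `Lset` of leaves. -/
noncomputable def PhiOf (σ : Equiv.Perm (Fin 3)) (t : Set Vertex)
    (v w l : ℕ → Vertex) (Lset : Set Vertex) : ℕ → ℕ∞ :=
  if σ = p231 then phi231 t v
  else if σ = p213 then phi213 t v
  else if σ = p312 then phi312 t w
  else if σ = p132 then phi132 t w
  else if σ = p321 then phi321Fun (sVal t l) (pVal l) Lset.encard
  else phi123Fun t.encard (phi321Fun (sVal t l) (pVal l) Lset.encard)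

open Classical in
noncomputable def canonSpine (t : Set Vertex) : ℕ → Vertex :=
  if h : ∃ η : ℕ → Vertex, IsSpine t η then h.choose else fun _ => []

open Classical in
noncomputable def canonV (t : Set Vertex) : ℕ → Vertex :=
  if h : ∃ v : ℕ → Vertex, IsLexEnum t v then h.choose else fun _ => []

open Classical in
noncomputable def canonW (t : Set Vertex) : ℕ → Vertex :=
  if h : ∃ w : ℕ → Vertex, IsLexCoEnum t w then h.choose else fun _ => []

open Classical in
noncomputable def canonL (t : Set Vertex) : ℕ → Vertex :=
  if h : ∃ l : ℕ → Vertex, IsEnumOf (leftLeaves t (canonSpine t)) l then h.choose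
  else fun _ => []

/-- `Φ^σ_t` for an infinite tree `t ∈ 𝔗_∞`, using the canonical (unique) spine and
enumerations. -/
noncomputable def PhiCanon (σ : Equiv.Perm (Fin 3)) (t : Set Vertex) : ℕ → ℕ∞ :=
  PhiOf σ t (canonV t) (canonW t) (canonL t) (leftLeaves t (canonSpine t))

/-- σ-algebra on the space of trees: all sets are measurable. -/
instance : MeasurableSpace (Set Vertex) := ⊤

/-- `μ` is the law of a Galton–Watson tree with offspring distribution `ξ`:
a probability measure, supported on trees, giving each finite tree `t` the
probability `∏_{u ∈ t} ξ(d_t(u))`. -/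
def IsGW (ξ : ℕ → ℝ≥0∞) (μ : Measure (Set Vertex)) : Prop :=
  IsProbabilityMeasure μ ∧ μ {t | IsTree t} = 1 ∧
    ∀ t : Set Vertex, IsTree t → ∀ ht : t.Finite,
      μ {t} = ∏ u ∈ ht.toFinset, ξ (childCount t u)

/-- `π` is the permutation `Φ^{321}_t` of `[n]` associated to a finite tree `t` with
`n+1` vertices: for every leaf `v` with `s = #{x ∈ t : x < v}` and `p = |v|`, position
`s - p + 1` is mapped to `s` (in 0-indexed form: position `s - p` to value `s - 1`),
and `π` is increasing on the remaining positions. -/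
def Is321Image (n : ℕ) (t : Set Vertex) (π : Equiv.Perm (Fin n)) : Prop :=
  (∀ v : Vertex, IsLeaf t v →
    ∃ hb : {x ∈ t | x < v}.ncard - v.length < n,
      ((π ⟨{x ∈ t | x < v}.ncard - v.length, hb⟩ : Fin n) : ℕ)
        = {x ∈ t | x < v}.ncard - 1) ∧
  ∀ a b : Fin n, a < b →
    (∀ v : Vertex, IsLeaf t v → {x ∈ t | x < v}.ncard - v.length ≠ (a : ℕ)) →
    (∀ v : Vertex, IsLeaf t v → {x ∈ t | x < v}.ncard - v.length ≠ (b : ℕ)) →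
    π a < π b

/-- `π` is the permutation `Φ^{123}_t = (n+1) - Φ^{321}_t` of `[n]`. -/
def Is123Image (n : ℕ) (t : Set Vertex) (π : Equiv.Perm (Fin n)) : Prop :=
  ∃ π' : Equiv.Perm (Fin n), Is321Image n t π' ∧ ∀ i : Fin n, π i = Fin.rev (π' i)


/-! ## Prefixes and the lexicographic order -/

lemma comparable_of_isPrefix {u v x : Vertex} (hu : u <+: x) (hv : v <+: x) :
    u <+: v ∨ v <+: u :=
  (le_total _ _).imp (List.prefix_of_prefix_length_le hu hv)
    (List.prefix_of_prefix_length_le hv hu)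

lemma le_of_isPrefix {u v : Vertex} (h : u <+: v) : u ≤ v := by
  induction u generalizing v with
  | nil => exact not_lt.1 (List.not_lt_nil v)
  | cons a u ih =>
    obtain ⟨y, rfl⟩ := h
    have := ih (List.prefix_append u y)
    rw [List.cons_append, ← not_lt, List.cons_lt_cons_iff]
    simpa using this

lemma lt_of_isPrefix {u v : Vertex} (h : u <+: v) (hne : u ≠ v) : u < v :=
  lt_of_le_of_ne (le_of_isPrefix h) hne

lemma append_lt_of_not_isPrefix {u v : Vertex} (h : u < v) (hp : ¬ u <+: v) (y : Vertex) :
    u ++ y < v := by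
  induction u generalizing v with
  | nil => exact absurd ⟨_, rfl⟩ hp
  | cons a u ih =>
    cases v with
    | nil => exact absurd h (List.not_lt_nil _)
    | cons b v =>
      rw [List.cons_append, List.cons_lt_cons_iff]
      rw [List.cons_lt_cons_iff] at h
      rcases h with h | ⟨rfl, h⟩
      · exact Or.inl h
      · exact Or.inr ⟨rfl, ih h fun h' => hp (List.cons_prefix_cons.2 ⟨rfl, h'⟩)⟩

lemma lt_of_prefix_of_not_isPrefix {u v x y : Vertex} (h : u < v) (hp : ¬ u <+: v)
    (hx : u <+: x) (hy : v <+: y) : x < y := by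
  obtain ⟨z, rfl⟩ := hx
  exact (append_lt_of_not_isPrefix h hp z).trans_le (le_of_isPrefix hy)

lemma not_prefix_of_isPrefix {u v x y : Vertex} (h : u < v) (hp : ¬ u <+: v)
    (hx : u <+: x) (hy : v <+: y) : ¬ x <+: y := fun hxy =>
  (comparable_of_isPrefix (hx.trans hxy) hy).elim hp
    fun hvu => (le_of_isPrefix hvu).not_gt h

lemma prefix_of_le_of_lt {u v x : Vertex} (hux : u ≤ x) (hxv : x < v) (huv : u <+: v) :
    u <+: x := by
  rcases hux.eq_or_lt with rfl | hux
  · exact List.prefix_rfl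
  · by_contra hp
    obtain ⟨y, rfl⟩ := huv
    exact (append_lt_of_not_isPrefix hux hp y).not_gt hxv

lemma append_singleton_lt {u : Vertex} {a b : ℕ} (h : a < b) : u ++ [a] < u ++ [b] := by
  induction u with
  | nil => simpa [List.cons_lt_cons_iff] using h
  | cons c u ih => simpa [List.cons_lt_cons_iff] using ih

lemma prefix_of_prefix_append_singleton {u v : Vertex} {a : ℕ} (h : u <+: v ++ [a])
    (hne : u ≠ v ++ [a]) : u <+: v :=
  (List.prefix_concat_iff.1 h).resolve_left hne

/-! ## Postorder ranks -/

/-- The vertices of `t` that do not come after `u` in postorder. -/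
def postSet (t : Set Vertex) (u : Vertex) : Set Vertex :=
  {x ∈ t | (x < u ∧ ¬ x <+: u) ∨ u <+: x}

/-- The (1-based) rank of `u` in the postorder of `t`. -/
noncomputable def postRank (t : Set Vertex) (u : Vertex) : ℕ := (postSet t u).ncard

lemma postSet_subset (t : Set Vertex) (u : Vertex) : postSet t u ⊆ t := fun _ h => h.1

lemma mem_postSet_self {t : Set Vertex} {u : Vertex} (hu : u ∈ t) : u ∈ postSet t u :=
  ⟨hu, Or.inr List.prefix_rfl⟩

lemma postRank_lt_of_isPrefix {t : Set Vertex} (ht : t.Finite) {u v : Vertex} (hu : u ∈ t)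
    (huv : u <+: v) (hlt : u < v) : postRank t v < postRank t u := by
  refine Set.ncard_lt_ncard ⟨?_, fun h => ?_⟩ (ht.subset (postSet_subset t u))
  · rintro x ⟨hx, ⟨hxv, hp⟩ | hvx⟩
    · refine ⟨hx, ?_⟩
      rcases lt_or_ge x u with hxu | hux
      · exact Or.inl ⟨hxu, fun h => hp (h.trans huv)⟩
      · exact Or.inr (prefix_of_le_of_lt hux hxv huv)
    · exact ⟨hx, Or.inr (huv.trans hvx)⟩
  · rcases (h (mem_postSet_self hu)).2 with h | h
    · exact h.2 huv
    · exact (le_of_isPrefix h).not_gt hlt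

lemma postRank_lt_of_not_isPrefix {t : Set Vertex} (ht : t.Finite) {u v : Vertex} (hv : v ∈ t)
    (huv : ¬ u <+: v) (hlt : u < v) : postRank t u < postRank t v := by
  refine Set.ncard_lt_ncard ⟨?_, fun h => ?_⟩ (ht.subset (postSet_subset t v))
  · rintro x ⟨hx, ⟨hxu, hp⟩ | hux⟩
    · exact ⟨hx, Or.inl ⟨hxu.trans hlt, fun h => hp (prefix_of_le_of_lt hxu.le hlt h)⟩⟩
    · exact ⟨hx, Or.inl ⟨lt_of_prefix_of_not_isPrefix hlt huv hux List.prefix_rfl,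
        not_prefix_of_isPrefix hlt huv hux List.prefix_rfl⟩⟩
  · rcases (h (mem_postSet_self hv)).2 with h | h
    · exact h.1.not_gt hlt
    · exact huv h

lemma postRank_lt_iff {t : Set Vertex} (ht : t.Finite) {u v : Vertex} (hu : u ∈ t) (hv : v ∈ t)
    (hlt : u < v) : postRank t v < postRank t u ↔ u <+: v :=
  ⟨fun h => by_contra fun hp => (postRank_lt_of_not_isPrefix ht hv hp hlt).not_gt h,
    fun h => postRank_lt_of_isPrefix ht hu h hlt⟩

lemma postRank_ne {t : Set Vertex} (ht : t.Finite) {u v : Vertex} (hu : u ∈ t) (hv : v ∈ t)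
    (hlt : u < v) : postRank t u ≠ postRank t v := by
  by_cases h : u <+: v
  · exact (postRank_lt_of_isPrefix ht hu h hlt).ne'
  · exact (postRank_lt_of_not_isPrefix ht hv h hlt).ne

lemma postRank_pos {t : Set Vertex} (ht : t.Finite) {u : Vertex} (hu : u ∈ t) :
    0 < postRank t u :=
  (Set.ncard_pos (ht.subset (postSet_subset t u))).2 ⟨u, mem_postSet_self hu⟩

lemma postRank_lt_ncard {t : Set Vertex} (ht : t.Finite) (h0 : [] ∈ t) {u : Vertex}
    (hu : u ≠ []) : postRank t u < t.ncard := by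
  refine Set.ncard_lt_ncard ⟨postSet_subset t u, fun h => ?_⟩ ht
  rcases (h h0).2 with h | h
  · exact h.2 ⟨_, rfl⟩
  · exact hu (List.prefix_nil.1 h)

lemma ncard_proper_prefixes (u : Vertex) : {x : Vertex | x <+: u ∧ x < u}.ncard = u.length := by
  have h : {x : Vertex | x <+: u ∧ x < u} = (fun m => u.take m) '' Set.Iio u.length := by
    ext x
    constructor
    · rintro ⟨hx, hlt⟩
      refine ⟨x.length, lt_of_le_of_ne hx.length_le fun h => hlt.ne (hx.eq_of_length h), ?_⟩
      exact (List.prefix_iff_eq_take.1 hx).symm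
    · rintro ⟨m, hm, rfl⟩
      have hp : u.take m <+: u := ⟨_, List.take_append_drop m u⟩
      refine ⟨hp, lt_of_isPrefix hp fun h => ?_⟩
      have := congrArg List.length h
      simp only [List.length_take, Set.mem_Iio] at this hm
      omega
  rw [h, Set.InjOn.ncard_image, ← Finset.coe_Iio, Set.ncard_coe_finset, Nat.card_Iio]
  intro a ha b hb hab
  have := congrArg List.length hab
  simp only [List.length_take, Set.mem_Iio] at this ha hb
  omega

/-- The postorder rank of `u` is its preorder rank plus the size of its fringe subtree
minus its height. -/
lemma ncard_lt_add_ncard_fringe {t : Set Vertex} (hT : IsTree t) (ht : t.Finite) {u : Vertex}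
    (hu : u ∈ t) :
    {x ∈ t | x < u}.ncard + (fringe t u).ncard = postRank t u + u.length := by
  have hA : {x ∈ t | x < u} = {x ∈ t | x < u ∧ ¬ x <+: u} ∪ {x | x <+: u ∧ x < u} := by
    ext x
    constructor
    · rintro ⟨hx, hlt⟩
      by_cases hp : x <+: u
      · exact Or.inr ⟨hp, hlt⟩
      · exact Or.inl ⟨hx, hlt, hp⟩
    · rintro (⟨hx, hlt, -⟩ | ⟨⟨y, rfl⟩, hlt⟩)
      · exact ⟨hx, hlt⟩
      · exact ⟨hT.2.1 _ _ hu, hlt⟩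
  have hQ : postSet t u = {x ∈ t | x < u ∧ ¬ x <+: u} ∪ fringe t u := by
    ext x
    simp only [postSet, fringe, Set.mem_ofPred_eq, Set.mem_union]
    tauto
  have hfin : {x ∈ t | x < u ∧ ¬ x <+: u}.Finite := ht.subset fun _ h => h.1
  have hpre : {x : Vertex | x <+: u ∧ x < u}.Finite := by
    refine ht.subset ?_
    rintro x ⟨⟨y, rfl⟩, -⟩
    exact hT.2.1 _ _ hu
  rw [postRank, hA, hQ, Set.ncard_union_eq _ hfin hpre, Set.ncard_union_eq _ hfin
    (ht.subset fun _ h => h.1), ncard_proper_prefixes]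
  · omega
  · rw [Set.disjoint_left]
    rintro x ⟨-, hlt, -⟩ ⟨-, hp⟩
    exact (le_of_isPrefix hp).not_gt hlt
  · rw [Set.disjoint_left]
    rintro x ⟨-, -, hn⟩ ⟨hp, -⟩
    exact hn hp

/-! ## Enumerations -/

lemma isLexEnum_iff {n : ℕ} {t : Set Vertex} (hc : t.encard = (n : ℕ∞) + 1) {v : ℕ → Vertex} :
    IsLexEnum t v ↔ StrictMonoOn v (Set.Iic n) ∧ v '' Set.Iic n = t := by
  have hlt : ∀ i : ℕ, (i : ℕ∞) < t.encard ↔ i ≤ n := fun i => by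
    rw [hc, ← Nat.cast_one, ← Nat.cast_add, Nat.cast_lt, Nat.lt_succ_iff]
  have htf : t.Finite := Set.finite_of_encard_eq_coe (k := n + 1) (by simpa using hc)
  simp only [IsLexEnum, hlt]
  constructor
  · intro h
    have hmono : StrictMonoOn v (Set.Iic n) := fun j _ k hk hjk => by
      have : v j ∈ {x ∈ t | x < v k} := by
        rw [(h k hk).2]
        exact ⟨j, hjk, rfl⟩
      exact this.2
    refine ⟨hmono, Set.Finite.eq_of_subset_of_encard_le ((Set.finite_Iic n).image v) ?_ ?_⟩
    · rintro _ ⟨k, hk, rfl⟩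
      exact (h k hk).1
    · rw [hmono.injOn.encard_image, hc, ← Finset.coe_Iic, Set.encard_coe_eq_coe_finsetCard,
        Nat.card_Iic]
      simp
  · rintro ⟨hmono, rfl⟩ k hk
    refine ⟨⟨k, hk, rfl⟩, ?_⟩
    ext x
    constructor
    · rintro ⟨⟨j, hj, rfl⟩, hjk⟩
      exact ⟨j, (hmono.lt_iff_lt hj hk).1 hjk, rfl⟩
    · rintro ⟨j, hj, rfl⟩
      have hj' : j < k := hj
      exact ⟨⟨j, hj'.le.trans hk, rfl⟩, hmono (hj'.le.trans hk) hk hj'⟩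

lemma exists_isLexEnum {n : ℕ} {t : Set Vertex} (hc : t.encard = (n : ℕ∞) + 1) :
    ∃ v, IsLexEnum t v := by
  have htf : t.Finite := Set.finite_of_encard_eq_coe (k := n + 1) (by simpa using hc)
  have hcard : htf.toFinset.card = n + 1 := by
    have := htf.encard_eq_coe_toFinset_card
    rw [hc] at this
    exact_mod_cast this.symm
  set e := htf.toFinset.orderEmbOfFin hcard with he
  refine ⟨fun k => if h : k < n + 1 then e ⟨k, h⟩ else [], (isLexEnum_iff hc).2 ⟨?_, ?_⟩⟩
  · intro j hj k hk hjk
    have hj' : j < n + 1 := Nat.lt_succ_of_le hj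
    have hk' : k < n + 1 := Nat.lt_succ_of_le hk
    simpa [hj', hk'] using hjk
  · ext x
    have hr := htf.toFinset.range_orderEmbOfFin hcard
    rw [htf.coe_toFinset] at hr
    rw [← hr]
    constructor
    · rintro ⟨k, hk, rfl⟩
      have hk' : k < n + 1 := Nat.lt_succ_of_le hk
      exact ⟨⟨k, hk'⟩, by simp [hk', he]⟩
    · rintro ⟨k, rfl⟩
      exact ⟨k, Nat.lt_succ_iff.1 k.2, by simp only [k.2, dif_pos, he]⟩

lemma enum_zero {n : ℕ} {t : Set Vertex} (hT : IsTree t) {v : ℕ → Vertex}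
    (hmono : StrictMonoOn v (Set.Iic n)) (him : v '' Set.Iic n = t) : v 0 = [] := by
  obtain ⟨k, hk, hk0⟩ := him.symm ▸ hT.1
  rcases Nat.eq_zero_or_pos k with rfl | hpos
  · exact hk0
  · have := hmono (Nat.zero_le n) hk hpos
    rw [hk0] at this
    exact absurd this (List.not_lt_nil _)

lemma phi132_eq_postRank {n : ℕ} {t : Set Vertex} (hT : IsTree t)
    (hc : t.encard = (n : ℕ∞) + 1) {v : ℕ → Vertex} (hv : IsLexEnum t v) {i : ℕ} (hi : i < n) :
    phi132 t (fun j => v (n - j)) (i + 1) = (postRank t (v (n - i)) : ℕ∞) := by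
  obtain ⟨hmono, him⟩ := (isLexEnum_iff hc).1 hv
  have htf : t.Finite := Set.finite_of_encard_eq_coe (k := n + 1) (by simpa using hc)
  have hk : n - i ≤ n := Nat.sub_le n i
  have hlt : ((n - i : ℕ) : ℕ∞) < t.encard := by
    rw [hc]
    exact_mod_cast Nat.lt_succ_of_le hk
  have hcard : {x ∈ t | x < v (n - i)}.ncard = n - i := by
    rw [(hv _ hlt).2, Set.InjOn.ncard_image]
    · change (Set.Iio (n - i)).ncard = n - i
      rw [← Finset.coe_Iio, Set.ncard_coe_finset, Nat.card_Iio]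
    · exact hmono.injOn.mono fun j (hj : j < n - i) => hj.le.trans hk
  have hrank := ncard_lt_add_ncard_fringe hT htf (hv _ hlt).1
  have hfr : (fringe t (v (n - i))).encard = ((fringe t (v (n - i))).ncard : ℕ∞) :=
    ((htf.subset fun _ h => h.1).cast_ncard_eq).symm
  have hi' : 1 ≤ i + 1 ∧ ((i + 1 : ℕ) : ℕ∞) < t.encard := by
    refine ⟨Nat.le_add_left 1 i, ?_⟩
    rw [hc]
    exact_mod_cast Nat.succ_lt_succ hi
  simp only [phi132, if_pos hi', Nat.add_sub_cancel]
  rw [hc, hfr]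
  norm_cast
  omega

/-- Two trees whose lexicographic enumerations have the same ancestor relation coincide. -/
lemma enum_unique {n : ℕ} {t t' : Set Vertex} (hT : IsTree t) (hT' : IsTree t')
    {v v' : ℕ → Vertex} (hmono : StrictMonoOn v (Set.Iic n)) (him : v '' Set.Iic n = t)
    (hmono' : StrictMonoOn v' (Set.Iic n)) (him' : v' '' Set.Iic n = t')
    (hanc : ∀ j k, j < k → k ≤ n → (v j <+: v k ↔ v' j <+: v' k)) :
    ∀ k ≤ n, v k = v' k := by
  intro k
  induction k using Nat.strong_induction_on with
  | _ k ih =>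
  intro hk
  rcases Nat.eq_zero_or_pos k with rfl | hpos
  · rw [enum_zero hT hmono him, enum_zero hT' hmono' him']
  have parent_isPrefix : ∀ {s s' : Set Vertex} {w w' : ℕ → Vertex}, IsTree s →
      StrictMonoOn w (Set.Iic n) → w '' Set.Iic n = s → StrictMonoOn w' (Set.Iic n) →
      (∀ j < k, w j = w' j) → (∀ j < k, w j <+: w k → w' j <+: w' k) →
      ∀ u u' a a', w k = u ++ [a] → w' k = u' ++ [a'] → u <+: u' := by
    intro s s' w w' hs hw hws hw' hagree hpre u u' a a' hu hu'
    have hus : u ∈ s := hs.2.1 u [a] (by rw [← hu, ← hws]; exact ⟨k, hk, rfl⟩)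
    obtain ⟨m, hm, rfl⟩ := hws.symm ▸ hus
    have hmk : m < k := by
      rw [← hw.lt_iff_lt hm hk, hu]
      exact lt_of_isPrefix (List.prefix_append _ _) (by simp)
    rw [hagree m hmk]
    have hp := hpre m hmk (by rw [hu]; exact List.prefix_append _ _)
    rw [hu'] at hp
    exact prefix_of_prefix_append_singleton hp
      (hu' ▸ (hw' (hmk.le.trans hk) hk hmk).ne)
  have no_smaller : ∀ {s' : Set Vertex} {w w' : ℕ → Vertex}, IsTree s' →
      StrictMonoOn w (Set.Iic n) → StrictMonoOn w' (Set.Iic n) → w' '' Set.Iic n = s' →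
      (∀ j < k, w j = w' j) → ∀ u a a', w k = u ++ [a] → w' k = u ++ [a'] → ¬ a < a' := by
    intro s' w w' hs hw hw' hws hagree u a a' hu hu' haa
    have hmem : u ++ [a] ∈ s' :=
      hs.2.2 u a' a (by rw [← hu', ← hws]; exact ⟨k, hk, rfl⟩) haa.le
    obtain ⟨m, hm, hma⟩ := hws.symm ▸ hmem
    have hmk : m < k := by
      rw [← hw'.lt_iff_lt hm hk, hma, hu']
      exact append_singleton_lt haa
    rw [← hagree m hmk, ← hu] at hma
    exact (hw (hmk.le.trans hk) hk hmk).ne hma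
  have exists_concat : ∀ {s : Set Vertex} {w : ℕ → Vertex}, IsTree s →
      StrictMonoOn w (Set.Iic n) → w '' Set.Iic n = s → ∃ u a, w k = u ++ [a] := by
    intro s w hs hw hws
    have hne : w k ≠ [] := by
      rw [← enum_zero hs hw hws]
      exact (hw (Nat.zero_le n) hk hpos).ne'
    exact ⟨_, _, (List.dropLast_append_getLast hne).symm⟩
  obtain ⟨u, a, hu⟩ := exists_concat hT hmono him
  obtain ⟨u', a', hu'⟩ := exists_concat hT' hmono' him'
  have hag : ∀ j < k, v j = v' j := fun j hj => ih j hj (hj.le.trans hk)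
  have hag' : ∀ j < k, v' j = v j := fun j hj => (hag j hj).symm
  have huu : u = u' :=
    List.IsPrefix.eq_of_length_le
      (parent_isPrefix (s' := t') hT hmono him hmono' hag (fun j hj => (hanc j k hj hk).1) _ _ _ _
        hu hu')
      (parent_isPrefix (s' := t) hT' hmono' him' hmono hag' (fun j hj => (hanc j k hj hk).2) _ _ _ _
        hu' hu).length_le
  subst huu
  have haa : a = a' := le_antisymm
    (not_lt.1 (no_smaller hT hmono' hmono him hag' _ _ _ hu' hu))
    (not_lt.1 (no_smaller hT' hmono hmono' him' hag _ _ _ hu hu'))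
  rw [hu, hu', haa]

/-! ## The tree of an ancestor relation -/

/-- `A j k` behaves like "`j` is a proper ancestor of `k`" for labels in preorder. -/
structure IsAncestry (A : ℕ → ℕ → Prop) : Prop where
  lt : ∀ {j k}, A j k → j < k
  root : ∀ {k}, 0 < k → A 0 k
  trans : ∀ {i j k}, A i j → A j k → A i k
  interval : ∀ {i j k}, A i k → i < j → j < k → A i j

open Classical in
/-- The greatest proper ancestor of `k`. -/
noncomputable def parent (A : ℕ → ℕ → Prop) (k : ℕ) : ℕ :=
  Nat.findGreatest (fun j => A j k) (k - 1)

lemma parent_succ_lt (A : ℕ → ℕ → Prop) (k : ℕ) : parent A (k + 1) < k + 1 := by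
  classical
  exact Nat.lt_succ_of_le (Nat.findGreatest_le k)

open Classical in
/-- The Ulam–Harris vertex with preorder label `k` in the tree with ancestor relation `A`. -/
noncomputable def ancestryVertex (A : ℕ → ℕ → Prop) : ℕ → Vertex
  | 0 => []
  | k + 1 =>
    have := parent_succ_lt A k
    ancestryVertex A (parent A (k + 1)) ++
      [Nat.count (fun j => 0 < j ∧ parent A j = parent A (k + 1)) (k + 1)]

lemma exists_lt_count_eq {p : ℕ → Prop} [DecidablePred p] {k i : ℕ} (h : i < Nat.count p k) :
    ∃ j < k, p j ∧ Nat.count p j = i := by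
  induction k with
  | zero => simp at h
  | succ k ih =>
    rcases lt_or_ge i (Nat.count p k) with hi | hi
    · obtain ⟨j, hj, h'⟩ := ih hi
      exact ⟨j, hj.trans (Nat.lt_succ_self k), h'⟩
    · rw [Nat.count_succ] at h
      by_cases hp : p k
      · rw [if_pos hp] at h
        exact ⟨k, Nat.lt_succ_self k, hp, by omega⟩
      · rw [if_neg hp] at h
        omega

namespace IsAncestry

variable {A : ℕ → ℕ → Prop}

lemma parent_rel (hA : IsAncestry A) {k : ℕ} (hk : 0 < k) : A (parent A k) k := by
  classical
  exact Nat.findGreatest_spec (P := fun j => A j k) (Nat.zero_le _) (hA.root hk)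

lemma le_parent (hA : IsAncestry A) {j k : ℕ} (h : A j k) : j ≤ parent A k := by
  classical
  exact Nat.le_findGreatest (Nat.le_sub_one_of_lt (hA.lt h)) h

lemma parent_lt (hA : IsAncestry A) {k : ℕ} (hk : 0 < k) : parent A k < k :=
  hA.lt (hA.parent_rel hk)

open Classical in
lemma vertex_eq {k : ℕ} (hk : 0 < k) : ancestryVertex A k =
    ancestryVertex A (parent A k) ++
      [Nat.count (fun j => 0 < j ∧ parent A j = parent A k) k] := by
  obtain ⟨k, rfl⟩ := Nat.exists_eq_succ_of_ne_zero hk.ne'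
  rw [Nat.succ_eq_add_one, ancestryVertex]

lemma parent_vertex_isPrefix {k : ℕ} (hk : 0 < k) :
    ancestryVertex A (parent A k) <+: ancestryVertex A k := by
  rw [vertex_eq hk]
  exact List.prefix_append _ _

lemma prefix_of_rel (hA : IsAncestry A) {j k : ℕ} (h : A j k) :
    ancestryVertex A j <+: ancestryVertex A k := by
  induction k using Nat.strong_induction_on with
  | _ k ih =>
  have hk : 0 < k := (Nat.zero_le j).trans_lt (hA.lt h)
  rcases (hA.le_parent h).eq_or_lt with rfl | hlt
  · exact parent_vertex_isPrefix hk
  · exact (ih _ (hA.parent_lt hk) (hA.interval h hlt (hA.parent_lt hk))).trans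
      (parent_vertex_isPrefix hk)

lemma lt_and_not_prefix_of_not_rel (hA : IsAncestry A) {j k : ℕ} (hjk : j < k) (h : ¬ A j k) :
    ancestryVertex A j < ancestryVertex A k ∧ ¬ ancestryVertex A j <+: ancestryVertex A k := by
  induction hs : j + k using Nat.strong_induction_on generalizing j k with
  | _ s ih =>
  have hk : 0 < k := (Nat.zero_le j).trans_lt hjk
  have hj : 0 < j := Nat.pos_of_ne_zero fun hj => h (hj ▸ hA.root hk)
  have hpk := hA.parent_lt hk
  have hpj := hA.parent_lt hj
  rcases lt_trichotomy j (parent A k) with hlt | rfl | hlt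
  · obtain ⟨h1, h2⟩ := ih _ (by omega) hlt (fun h' => h (hA.trans h' (hA.parent_rel hk))) rfl
    have hp := parent_vertex_isPrefix (A := A) hk
    exact ⟨lt_of_prefix_of_not_isPrefix h1 h2 List.prefix_rfl hp,
      not_prefix_of_isPrefix h1 h2 List.prefix_rfl hp⟩
  · exact absurd (hA.parent_rel hk) h
  · rcases (hA.le_parent (hA.interval (hA.parent_rel hk) hlt hjk)).eq_or_lt with heq | hlt'
    · classical
      have hcount := Nat.count_strict_mono
        (p := fun i => 0 < i ∧ parent A i = parent A k) ⟨hj, heq.symm⟩ hjk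
      rw [vertex_eq hj, vertex_eq hk, ← heq]
      refine ⟨append_singleton_lt hcount, fun hp => ?_⟩
      rw [List.prefix_append_right_inj, List.cons_prefix_cons] at hp
      exact hcount.ne hp.1
    · obtain ⟨h1, h2⟩ := ih _ (by omega) (hpj.trans hjk)
        (fun h' => hlt'.not_ge (hA.le_parent h')) rfl
      have hp := parent_vertex_isPrefix (A := A) hj
      exact ⟨lt_of_prefix_of_not_isPrefix h1 h2 hp List.prefix_rfl,
        not_prefix_of_isPrefix h1 h2 hp List.prefix_rfl⟩

lemma prefix_iff (hA : IsAncestry A) {j k : ℕ} (hjk : j < k) :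
    ancestryVertex A j <+: ancestryVertex A k ↔ A j k :=
  ⟨fun h => by_contra fun hn => (hA.lt_and_not_prefix_of_not_rel hjk hn).2 h, hA.prefix_of_rel⟩

lemma strictMono (hA : IsAncestry A) : StrictMono (ancestryVertex A) := by
  have hne : ∀ k, ancestryVertex A (parent A k) = ancestryVertex A k → k = 0 := fun k h => by
    by_contra hk
    rw [vertex_eq (A := A) (Nat.pos_of_ne_zero hk)] at h
    simp at h
  intro j k hjk
  by_cases h : A j k
  · have hk : 0 < k := (Nat.zero_le j).trans_lt hjk
    refine lt_of_isPrefix (hA.prefix_of_rel h) fun heq => hk.ne' (hne k ?_)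
    have hp : ancestryVertex A j <+: ancestryVertex A (parent A k) := by
      rcases (hA.le_parent h).eq_or_lt with hj | hlt
      · rw [hj]
      · exact hA.prefix_of_rel (hA.interval h hlt (hA.parent_lt hk))
    rw [heq] at hp
    exact (parent_vertex_isPrefix hk).eq_of_length_le hp.length_le
  · exact (hA.lt_and_not_prefix_of_not_rel hjk h).1

lemma isTree (hA : IsAncestry A) (n : ℕ) : IsTree (ancestryVertex A '' Set.Iic n) := by
  have hconcat : ∀ {u : Vertex} {i k : ℕ}, ancestryVertex A k = u ++ [i] → 0 < k := by
    intro u i k h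
    refine Nat.pos_of_ne_zero ?_
    rintro rfl
    simp [ancestryVertex] at h
  refine ⟨⟨0, Nat.zero_le n, by rw [ancestryVertex]⟩, ?_, ?_⟩
  · intro u w
    induction w using List.reverseRecOn with
    | nil => simp
    | append_singleton w a ih =>
      rintro ⟨k, hk, h⟩
      rw [← List.append_assoc] at h
      have hpos := hconcat h
      rw [vertex_eq hpos] at h
      exact ih ⟨parent A k, (hA.parent_lt hpos).le.trans hk, (List.append_inj_left' h rfl)⟩
  · classical
    rintro u i j ⟨k, hk, h⟩ hji
    rcases hji.eq_or_lt with rfl | hlt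
    · exact ⟨k, hk, h⟩
    have hpos := hconcat h
    rw [vertex_eq hpos] at h
    obtain ⟨rfl, hi⟩ := List.append_inj' h rfl
    obtain rfl := List.singleton_inj.1 hi
    obtain ⟨m, hm, ⟨hm0, hmp⟩, rfl⟩ := exists_lt_count_eq hlt
    exact ⟨m, hm.le.trans hk, by rw [vertex_eq hm0, hmp]⟩

lemma encard_image (hA : IsAncestry A) (n : ℕ) :
    (ancestryVertex A '' Set.Iic n).encard = (n : ℕ∞) + 1 := by
  rw [hA.strictMono.injective.encard_image, ← Finset.coe_Iic, Set.encard_coe_eq_coe_finsetCard,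
    Nat.card_Iic]
  simp

end IsAncestry

/-! ## Permutations -/

lemma avoidsPat_p132_iff {n : ℕ} {π : Equiv.Perm (Fin n)} :
    AvoidsPat π p132 ↔ ∀ a b c : Fin n, a < b → b < c → π a < π c → ¬ π c < π b := by
  have h0 : p132 0 = 0 := rfl
  have h1 : p132 1 = 2 := rfl
  have h2 : p132 2 = 1 := rfl
  constructor
  · intro h a b c hab hbc hac hcb
    refine h ⟨![a, b, c], ?_, ?_⟩
    · rw [Fin.strictMono_iff_lt_succ]
      intro i
      fin_cases i
      · exact hab
      · exact hbc
    · intro j k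
      fin_cases j <;> fin_cases k <;>
        simp [h0, h1, h2, hac, hcb, hac.trans hcb, hac.le, hcb.le, (hac.trans hcb).le]
  · rintro h ⟨f, hf, hσ⟩
    refine h (f 0) (f 1) (f 2) (hf (by decide)) (hf (by decide)) ((hσ 0 2).1 ?_) ((hσ 2 1).1 ?_)
    · rw [h0, h2]
      decide
    · rw [h1, h2]
      decide

lemma perm_eq_of_lt_iff {n : ℕ} {π σ : Equiv.Perm (Fin n)}
    (h : ∀ i j, i < j → (π i < π j ↔ σ i < σ j)) : π = σ := by
  have hmono : StrictMono (π.symm.trans σ) := fun a b hab => by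
    obtain ⟨i, rfl⟩ := π.surjective a
    obtain ⟨j, rfl⟩ := π.surjective b
    simp only [Equiv.trans_apply, Equiv.symm_apply_apply]
    rcases lt_trichotomy i j with hij | rfl | hij
    · exact (h i j hij).1 hab
    · exact absurd hab (lt_irrefl _)
    · exact lt_of_le_of_ne (not_lt.1 fun h' => hab.not_gt ((h j i hij).2 h'))
        (σ.injective.ne hij.ne')
  have hid := Subsingleton.elim
    (hmono.orderIsoOfSurjective _ (π.symm.trans σ).surjective) (OrderIso.refl (Fin n))
  ext i
  have := congrArg (fun e : Fin n ≃o Fin n => e (π i)) hid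
  simp only [StrictMono.coe_orderIsoOfSurjective, Equiv.trans_apply, Equiv.symm_apply_apply,
    OrderIso.refl_apply] at this
  rw [this]

/-- The ancestor relation on preorder labels encoded by a `132`-avoiding permutation. -/
def permAncestor {n : ℕ} (π : Equiv.Perm (Fin n)) (j k : ℕ) : Prop :=
  (j = 0 ∧ 0 < k) ∨ ∃ a b : Fin n, a < b ∧ (a : ℕ) + k = n ∧ (b : ℕ) + j = n ∧ π a < π b

lemma isAncestry_permAncestor {n : ℕ} {π : Equiv.Perm (Fin n)}
    (hπ : ∀ a b c : Fin n, a < b → b < c → π a < π c → ¬ π c < π b) :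
    IsAncestry (permAncestor π) where
  lt := by
    rintro j k (⟨rfl, hk⟩ | ⟨a, b, hab, ha, hb, -⟩)
    · exact hk
    · omega
  root hk := Or.inl ⟨rfl, hk⟩
  trans := by
    rintro i j k (⟨rfl, hj⟩ | ⟨a, b, hab, ha, hb, hlt⟩) (⟨rfl, hk⟩ | ⟨c, d, hcd, hc, hd, hlt'⟩)
    · exact Or.inl ⟨rfl, hk⟩
    · exact Or.inl ⟨rfl, by omega⟩
    · omega
    · obtain rfl : a = d := by omega
      exact Or.inr ⟨c, b, hcd.trans hab, hc, hb, hlt'.trans hlt⟩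
  interval := by
    rintro i j k (⟨rfl, hk⟩ | ⟨a, b, hab, ha, hb, hlt⟩) hij hjk
    · exact Or.inl ⟨rfl, hij⟩
    · have hac : a < (⟨n - j, by omega⟩ : Fin n) := by
        rw [Fin.lt_def]
        change (a : ℕ) < n - j
        omega
      have hcb : (⟨n - j, by omega⟩ : Fin n) < b := by
        rw [Fin.lt_def]
        change n - j < (b : ℕ)
        omega
      refine Or.inr ⟨_, b, hcb, ?_, hb, ?_⟩
      · change n - j + j = n
        omega
      · exact lt_of_le_of_ne (not_lt.1 (hπ _ _ _ hac hcb hlt)) (π.injective.ne hcb.ne)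

lemma permAncestor_sub_iff {n : ℕ} {π : Equiv.Perm (Fin n)} {i j : Fin n} (hij : i < j) :
    permAncestor π (n - j) (n - i) ↔ π i < π j := by
  constructor
  · rintro (⟨h, -⟩ | ⟨a, b, -, ha, hb, hlt⟩)
    · omega
    · obtain rfl : a = i := by omega
      obtain rfl : b = j := by omega
      exact hlt
  · exact fun h => Or.inr ⟨i, j, hij, by omega, by omega, h⟩

section PhiValues

variable {n : ℕ} {t : Set Vertex} {v : ℕ → Vertex} {π : Equiv.Perm (Fin n)}

lemma existsUnique_perm (hT : IsTree t) (hc : t.encard = (n : ℕ∞) + 1) (hv : IsLexEnum t v) :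
    ∃! π : Equiv.Perm (Fin n), ∀ i : Fin n,
      (((π i : ℕ) + 1 : ℕ) : ℕ∞) = phi132 t (fun j => v (n - j)) ((i : ℕ) + 1) := by
  obtain ⟨hmono, him⟩ := (isLexEnum_iff hc).1 hv
  have htf : t.Finite := Set.finite_of_encard_eq_coe (k := n + 1) (by simpa using hc)
  have hcard : t.ncard = n + 1 := by
    rw [← htf.cast_ncard_eq] at hc
    exact_mod_cast hc
  have hmem : ∀ k ≤ n, v k ∈ t := fun k hk => him ▸ ⟨k, hk, rfl⟩
  have hpos : ∀ i : Fin n, 0 < postRank t (v (n - i)) := fun i =>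
    postRank_pos htf (hmem _ (Nat.sub_le _ _))
  have hle : ∀ i : Fin n, postRank t (v (n - i)) < n + 1 := fun i => by
    rw [← hcard]
    refine postRank_lt_ncard htf hT.1 ?_
    rw [← enum_zero hT hmono him]
    exact (hmono (Nat.zero_le n) (Nat.sub_le n i) (by omega)).ne'
  have hne : ∀ i j : Fin n, i < j → postRank t (v (n - i)) ≠ postRank t (v (n - j)) :=
    fun i j hij => (postRank_ne htf (hmem _ (Nat.sub_le _ _)) (hmem _ (Nat.sub_le _ _))
      (hmono (Nat.sub_le n j) (Nat.sub_le n i) (by omega))).symm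
  let f : Fin n → Fin n := fun i => ⟨postRank t (v (n - i)) - 1, by
    have := hle i
    have := i.2
    omega⟩
  have hf : Function.Injective f := fun i j h => by
    have h' : postRank t (v (n - i)) = postRank t (v (n - j)) := by
      have := Fin.mk.inj h
      have := hpos i
      have := hpos j
      omega
    rcases lt_trichotomy i j with hij | hij | hij
    · exact absurd h' (hne i j hij)
    · exact hij
    · exact absurd h'.symm (hne j i hij)
  refine ⟨Equiv.ofBijective f (Finite.injective_iff_bijective.1 hf), fun i => ?_, fun σ hσ => ?_⟩
  · rw [phi132_eq_postRank hT hc hv i.2, Equiv.ofBijective_apply]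
    exact congrArg _ (Nat.sub_add_cancel (hpos i))
  · ext i
    have h := hσ i
    rw [phi132_eq_postRank hT hc hv i.2, Nat.cast_inj] at h
    change (σ i : ℕ) = postRank t (v (n - i)) - 1
    omega

lemma lt_iff_isPrefix (hT : IsTree t) (hc : t.encard = (n : ℕ∞) + 1) (hv : IsLexEnum t v)
    (hπ : ∀ i : Fin n,
      (((π i : ℕ) + 1 : ℕ) : ℕ∞) = phi132 t (fun j => v (n - j)) ((i : ℕ) + 1))
    {i j : Fin n} (hij : i < j) : π i < π j ↔ v (n - j) <+: v (n - i) := by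
  obtain ⟨hmono, him⟩ := (isLexEnum_iff hc).1 hv
  have htf : t.Finite := Set.finite_of_encard_eq_coe (k := n + 1) (by simpa using hc)
  have hmem : ∀ k ≤ n, v k ∈ t := fun k hk => him ▸ ⟨k, hk, rfl⟩
  have hrank : ∀ i : Fin n, (π i : ℕ) + 1 = postRank t (v (n - i)) := fun i => by
    have h := hπ i
    rwa [phi132_eq_postRank hT hc hv i.2, Nat.cast_inj] at h
  rw [Fin.lt_def, ← Nat.add_lt_add_iff_right (k := 1), hrank, hrank]
  exact postRank_lt_iff htf (hmem _ (Nat.sub_le _ _)) (hmem _ (Nat.sub_le _ _))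
    (hmono (Nat.sub_le n j) (Nat.sub_le n i) (by omega))

lemma avoids_of_eq_phi132 (hT : IsTree t) (hc : t.encard = (n : ℕ∞) + 1) (hv : IsLexEnum t v)
    (hπ : ∀ i : Fin n,
      (((π i : ℕ) + 1 : ℕ) : ℕ∞) = phi132 t (fun j => v (n - j)) ((i : ℕ) + 1)) :
    AvoidsPat π p132 := by
  rw [avoidsPat_p132_iff]
  intro a b c hab hbc hac hcb
  rw [lt_iff_isPrefix hT hc hv hπ (hab.trans hbc)] at hac
  have hab' := (lt_iff_isPrefix hT hc hv hπ hab).1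
    (((lt_iff_isPrefix hT hc hv hπ (hab.trans hbc)).2 hac).trans hcb)
  refine hcb.not_gt ((lt_iff_isPrefix hT hc hv hπ hbc).2 ?_)
  refine (comparable_of_isPrefix hac hab').resolve_right fun h => ?_
  exact (le_of_isPrefix h).not_gt
    (((isLexEnum_iff hc).1 hv).1 (Nat.sub_le n c) (Nat.sub_le n b) (by omega))

end PhiValues

/-- The map `t ↦ Φ_t^{132}`, `Φ_t^{132}(i) = |t| - i + |t_{w_i}| - |w_i|`
with `w_i = v_{n+1-i}`, is a bijection from trees with `n+1` vertices onto `Av_n(132)`. -/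
theorem bijection_132 (n : ℕ) :
    (∀ t : TreeN n, ∃ v : ℕ → Vertex, IsLexEnum t.1 v) ∧
    (∀ t : TreeN n, ∀ v : ℕ → Vertex, IsLexEnum t.1 v →
      ∃! π : Equiv.Perm (Fin n), ∀ i : Fin n,
        (((π i : ℕ) + 1 : ℕ) : ℕ∞) = phi132 t.1 (fun j : ℕ => v (n - j)) ((i : ℕ) + 1)) ∧
    (∀ Φ : TreeN n → Equiv.Perm (Fin n),
      (∀ t : TreeN n, ∀ v : ℕ → Vertex, IsLexEnum t.1 v → ∀ i : Fin n,
        (((Φ t i : ℕ) + 1 : ℕ) : ℕ∞) = phi132 t.1 (fun j : ℕ => v (n - j)) ((i : ℕ) + 1)) →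
      Set.BijOn Φ Set.univ {π : Equiv.Perm (Fin n) | AvoidsPat π p132}) := by
  refine ⟨fun t => exists_isLexEnum t.2.2, fun t v hv => existsUnique_perm t.2.1 t.2.2 hv,
    fun Φ hΦ => ⟨fun t _ => ?_, fun t _ t' _ htt' => ?_, fun π hπ => ?_⟩⟩
  · obtain ⟨v, hv⟩ := exists_isLexEnum t.2.2
    exact avoids_of_eq_phi132 t.2.1 t.2.2 hv (hΦ t v hv)
  · obtain ⟨v, hv⟩ := exists_isLexEnum t.2.2
    obtain ⟨v', hv'⟩ := exists_isLexEnum t'.2.2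
    obtain ⟨hmono, him⟩ := (isLexEnum_iff t.2.2).1 hv
    obtain ⟨hmono', him'⟩ := (isLexEnum_iff t'.2.2).1 hv'
    have heq := enum_unique t.2.1 t'.2.1 hmono him hmono' him' fun j k hjk hk => by
      rcases Nat.eq_zero_or_pos j with rfl | hj
      · rw [enum_zero t.2.1 hmono him, enum_zero t'.2.1 hmono' him']
        exact iff_of_true ⟨_, rfl⟩ ⟨_, rfl⟩
      · have hlt : (⟨n - k, by omega⟩ : Fin n) < ⟨n - j, by omega⟩ := by
          rw [Fin.mk_lt_mk]
          omega
        have h := lt_iff_isPrefix t.2.1 t.2.2 hv (hΦ t v hv) hlt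
        have h' := lt_iff_isPrefix t'.2.1 t'.2.2 hv' (hΦ t' v' hv') hlt
        rw [← htt', h] at h'
        simpa only [Nat.sub_sub_self hk, Nat.sub_sub_self (hjk.le.trans hk)] using h'
    refine Subtype.ext ?_
    rw [← him, ← him']
    exact Set.image_congr fun k hk => heq k hk
  · have hA := isAncestry_permAncestor (avoidsPat_p132_iff.1 hπ)
    have hv := (isLexEnum_iff (hA.encard_image n)).2 ⟨hA.strictMono.strictMonoOn _, rfl⟩
    let t : TreeN n := ⟨_, hA.isTree n, hA.encard_image n⟩
    refine ⟨t, Set.mem_univ _, perm_eq_of_lt_iff fun i j hij => ?_⟩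
    rw [lt_iff_isPrefix t.2.1 t.2.2 hv (hΦ t _ hv) hij, hA.prefix_iff (by omega),
      permAncestor_sub_iff hij]

end AvoidPaper
end

section
/- Let t ∈ 𝔗_∞, let (l_1, l_2, …) be the leaves of t lying to the left of the infinite spine listed in increasing lexicographic order, and set s_i = #{v ∈ t : v < l_i} and p_i = |l_i| (the height of l_i). Then there is a unique increasing bijection from ℕ ∖ {s_i − p_i + 1 : i ≥ 1} to ℕ ∖ {s_i : i ≥ 1}. In particular both complements are infinite. -/
open Set Filter MeasureTheory Topology TopologicalSpace
open scoped ENNReal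

namespace AvoidPaper

theorem append_lt_append_of_lt_of_not_prefix {x y : Vertex} (h : x < y) (hp : ¬ x <+: y)
    (a b : Vertex) : x ++ a < y ++ b := by
  induction x generalizing y with
  | nil => exact absurd (List.nil_prefix) hp
  | cons i x ih =>
    cases y with
    | nil => cases h
    | cons j y =>
      simp only [List.cons_append, List.cons_lt_cons_iff, List.cons_prefix_cons] at *
      rcases h with h | ⟨rfl, h⟩
      · exact Or.inl h
      · exact Or.inr ⟨rfl, ih h fun h' => hp ⟨rfl, h'⟩⟩

theorem le_of_prefix {x y : Vertex} (h : x <+: y) : x ≤ y := by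
  obtain ⟨w, rfl⟩ := h
  induction x with
  | nil => exact not_lt.1 (List.not_lt_nil _)
  | cons i x ih =>
    refine not_lt.1 fun h => ?_
    rcases List.cons_lt_cons_iff.1 h with h | ⟨-, h⟩
    · exact lt_irrefl _ h
    · exact ih.not_gt h

theorem lt_of_lt_of_prefix {x y z : Vertex} (h : x < y) (hp : ¬ x <+: y) (hz : x <+: z) :
    z < y := by
  obtain ⟨w, rfl⟩ := hz
  simpa using append_lt_append_of_lt_of_not_prefix h hp w []

theorem append_singleton_lt_append_singleton (p : Vertex) {c d : ℕ} (h : c < d) :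
    p ++ [c] < p ++ [d] := by
  induction p with
  | nil => exact List.cons_lt_cons_iff.2 (Or.inl h)
  | cons i p ih => exact List.cons_lt_cons_iff.2 (Or.inr ⟨rfl, ih⟩)

/-- The vertices whose descendants include `z` form an interval below `z`. -/
theorem prefix_of_le_of_le {x y z : Vertex} (hxy : x ≤ y) (hyz : y ≤ z) (hz : x <+: z) :
    x <+: y := by
  by_contra hp
  rcases hxy.eq_or_lt with rfl | h
  · exact hp (List.prefix_refl x)
  · exact absurd (lt_of_lt_of_prefix h hp hz) hyz.not_gt

theorem IsLeaf.eq_of_prefix {t : Set Vertex} (ht : IsTree t) {v x : Vertex} (hv : IsLeaf t v)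
    (hx : x ∈ t) (h : v <+: x) : x = v := by
  obtain ⟨w, rfl⟩ := h
  cases w with
  | nil => simp
  | cons c w =>
    refine absurd (ht.2.1 (v ++ [c]) w ?_) (hv.2 c)
    simpa using hx

theorem IsSpine.length_eq {t : Set Vertex} {η : ℕ → Vertex} (h : IsSpine t η) (i : ℕ) :
    (η i).length = i := by
  induction i with
  | zero => simp [h.1]
  | succ i ih =>
    obtain ⟨c, hc⟩ := h.2.2 i
    simp [hc, ih]

theorem IsSpine.prefix_of_le {t : Set Vertex} {η : ℕ → Vertex} (h : IsSpine t η) {i j : ℕ}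
    (hij : i ≤ j) : η i <+: η j := by
  induction j, hij using Nat.le_induction with
  | base => exact List.prefix_refl _
  | succ j _ ih =>
    obtain ⟨c, hc⟩ := h.2.2 j
    rw [hc]
    exact ih.trans (List.prefix_append _ _)

theorem IsSpine.eq_of_prefix {t : Set Vertex} {η : ℕ → Vertex} (h : IsSpine t η) {v : Vertex}
    {j : ℕ} (hv : v <+: η j) : η v.length = v := by
  have hle : v.length ≤ j := h.length_eq j ▸ hv.length_le
  exact ((List.prefix_of_prefix_length_le hv (h.prefix_of_le hle)
    (h.length_eq _).ge).eq_of_length (h.length_eq _).symm).symm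

theorem fringe_subset_union {t : Set Vertex} (ht : IsTree t) (u : Vertex) :
    fringe t u ⊆ {u} ∪ ⋃ c ∈ children t u, fringe t (u ++ [c]) := by
  rintro x ⟨hx, w, rfl⟩
  cases w with
  | nil => simp
  | cons c w =>
    have hx' : (u ++ [c]) ++ w ∈ t := by simpa using hx
    refine Or.inr (mem_biUnion (x := c) (ht.2.1 _ _ hx') ⟨hx, w, by simp⟩)

theorem exists_infinite_fringe_child {t : Set Vertex} (ht : IsTree t) (hf : LocFin t)
    {u : Vertex} (hu : (fringe t u).Infinite) : ∃ c, (fringe t (u ++ [c])).Infinite := by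
  by_contra! h
  refine hu (((finite_singleton u).union ((hf u).biUnion fun c _ => h c)).subset
    (fringe_subset_union ht u))

theorem fringe_anti (t : Set Vertex) {u v : Vertex} (h : u <+: v) : fringe t v ⊆ fringe t u :=
  fun _ hx => ⟨hx.1, h.trans hx.2⟩

theorem mem_of_infinite_fringe {t : Set Vertex} (ht : IsTree t) {u : Vertex}
    (h : (fringe t u).Infinite) : u ∈ t := by
  obtain ⟨x, hx, w, rfl⟩ := h.nonempty
  exact ht.2.1 _ _ hx

/-- König's lemma: every vertex with infinitely many descendants lies on an infinite spine. -/
theorem exists_spine_of_infinite_fringe {t : Set Vertex} (ht : IsTree t) (hf : LocFin t)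
    {v : Vertex} (hv : (fringe t v).Infinite) : ∃ η, IsSpine t η ∧ η v.length = v := by
  let Q : Vertex → Prop := fun u => (fringe t u).Infinite ∧ (u <+: v ∨ v <+: u)
  have step : ∀ u : {u // Q u}, ∃ c, Q (u.1 ++ [c]) := by
    rintro ⟨u, hu, huv⟩
    by_cases h : v <+: u
    · obtain ⟨c, hc⟩ := exists_infinite_fringe_child ht hf hu
      exact ⟨c, hc, Or.inr (h.trans (List.prefix_append _ _))⟩
    · obtain ⟨w, rfl⟩ := huv.resolve_right h
      cases w with
      | nil => simp at h
      | cons c w =>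
        have hp : u ++ [c] <+: u ++ c :: w := ⟨w, by simp⟩
        exact ⟨c, hv.mono (fringe_anti t hp), Or.inl hp⟩
  choose f hstep using step
  let g : ℕ → {u // Q u} := fun n =>
    Nat.rec ⟨[], hv.mono (fringe_anti t List.nil_prefix), Or.inl List.nil_prefix⟩
      (fun _ u => ⟨u.1 ++ [f u], hstep u⟩) n
  have hs : IsSpine t fun n => (g n).1 :=
    ⟨rfl, fun i => mem_of_infinite_fringe ht (g i).2.1, fun i => ⟨f (g i), rfl⟩⟩
  refine ⟨_, hs, ?_⟩
  have hlen := hs.length_eq v.length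
  rcases (g v.length).2.2 with h | h
  · exact h.eq_of_length hlen
  · exact (h.eq_of_length hlen.symm).symm

theorem finite_lt_spine {t : Set Vertex} {η : ℕ → Vertex} (ht : IsTree t) (hf : LocFin t)
    (hη : IsSpine t η) (huniq : ∀ η', IsSpine t η' → η' = η) (j : ℕ) :
    {x ∈ t | x < η j}.Finite := by
  induction j with
  | zero => simp [hη.1]
  | succ j ih =>
    obtain ⟨c, hc⟩ := hη.2.2 j
    have hfin : ∀ d ∈ Iio c, (fringe t (η j ++ [d])).Finite := by
      intro d hd
      by_contra hinf
      obtain ⟨η', hη', hv⟩ := exists_spine_of_infinite_fringe ht hf hinf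
      rw [huniq η' hη', List.length_append, hη.length_eq, List.length_singleton, hc] at hv
      simp only [List.append_cancel_left_eq, List.cons.injEq, and_true] at hv
      exact (ne_of_gt hd) hv
    refine ((ih.union (finite_singleton (η j))).union ((finite_Iio c).biUnion hfin)).subset ?_
    rintro x ⟨hx, hlt⟩
    rcases lt_trichotomy x (η j) with h | h | h
    · exact Or.inl (Or.inl ⟨hx, h⟩)
    · exact Or.inl (Or.inr h)
    · right
      rw [hc] at hlt
      obtain ⟨w, rfl⟩ := prefix_of_le_of_le h.le hlt.le (List.prefix_append _ _)
      cases w with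
      | nil => simp at h
      | cons d w =>
        have hd : d < c := by
          by_contra hd
          refine hlt.not_ge ?_
          rcases (not_lt.1 hd).eq_or_lt with rfl | hcd
          · exact le_of_prefix ⟨w, by simp⟩
          · exact (append_singleton_lt_append_singleton (η j) hcd).le.trans
              (le_of_prefix ⟨w, by simp⟩)
        exact mem_biUnion (x := d) hd ⟨hx, w, by simp⟩

/-- The vertices preceding `v` that are not ancestors of `v`. -/
def sideBefore (t : Set Vertex) (v : Vertex) : Set Vertex := {x ∈ t | x < v ∧ ¬ x <+: v}

/-- The vertices up to the end of the subtree at `u` that are not strict ancestors of `u`. -/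
def sideThrough (t : Set Vertex) (u : Vertex) : Set Vertex :=
  {x ∈ t | (x < u ∧ ¬ x <+: u) ∨ u <+: x}

theorem sideThrough_subset_sideBefore (t : Set Vertex) {u v : Vertex} (h : u < v)
    (hp : ¬ u <+: v) : sideThrough t u ⊆ sideBefore t v := by
  rintro x ⟨hx, ⟨hlt, hnp⟩ | hux⟩
  · exact ⟨hx, hlt.trans h, fun hxv => hnp (prefix_of_le_of_le hlt.le h.le hxv)⟩
  · exact ⟨hx, lt_of_lt_of_prefix h hp hux, fun hxv => hp (hux.trans hxv)⟩

theorem sideBefore_subset_sideThrough_of_le (t : Set Vertex) {u v : Vertex} (h : v ≤ u) :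
    sideBefore t v ⊆ sideThrough t u := fun _ hx =>
  ⟨hx.1, Or.inl ⟨hx.2.1.trans_le h, fun hp => hx.2.2 (prefix_of_le_of_le hx.2.1.le h hp)⟩⟩

theorem sideBefore_subset_sideThrough_of_prefix (t : Set Vertex) {u v : Vertex} (h : u <+: v) :
    sideBefore t v ⊆ sideThrough t u := by
  rintro x ⟨hx, hlt, hnp⟩
  refine ⟨hx, ?_⟩
  by_cases hux : u <+: x
  · exact Or.inr hux
  · refine Or.inl ⟨lt_of_not_ge fun hle => hux (prefix_of_le_of_le hle hlt.le h), fun hxu => ?_⟩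
    exact hnp (hxu.trans h)

theorem sideThrough_subset_lt_spine {t : Set Vertex} {η : ℕ → Vertex} (hη : IsSpine t η)
    {u : Vertex} (hu : ∀ i, η i ≠ u) {j : ℕ} (hj : u < η j) :
    sideThrough t u ⊆ {x ∈ t | x < η j} := fun _ hx =>
  have hs := sideThrough_subset_sideBefore t hj (fun hp => hu _ (hη.eq_of_prefix hp)) hx
  ⟨hs.1, hs.2.1⟩

theorem ncard_strict_prefixes (v : Vertex) : {x : Vertex | x <+: v ∧ x ≠ v}.ncard = v.length := by
  have : {x : Vertex | x <+: v ∧ x ≠ v} = (fun n => v.take n) '' Iio v.length := by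
    ext x
    constructor
    · rintro ⟨hp, hne⟩
      refine ⟨x.length, ?_, (List.prefix_iff_eq_take.1 hp).symm⟩
      exact lt_of_le_of_ne hp.length_le fun h => hne (hp.eq_of_length h)
    · rintro ⟨n, hn, rfl⟩
      refine ⟨List.take_prefix _ _, fun h => ?_⟩
      have := congrArg List.length h
      simp only [List.length_take, mem_Iio] at this hn
      omega
  rw [this, InjOn.ncard_image]
  · simp [Set.ncard_eq_toFinset_card']
  · intro a ha b hb h
    have := congrArg List.length h
    simp only [List.length_take, mem_Iio] at this ha hb
    omega

theorem ncard_lt_sub_length {t : Set Vertex} (ht : IsTree t) {v : Vertex} (hv : v ∈ t)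
    (hfin : {x ∈ t | x < v}.Finite) :
    {x ∈ t | x < v}.ncard - v.length = (sideBefore t v).ncard := by
  have hsub : {x : Vertex | x <+: v ∧ x ≠ v} ⊆ {x ∈ t | x < v} := by
    rintro x ⟨hp, hne⟩
    refine ⟨?_, (le_of_prefix hp).lt_of_ne hne⟩
    obtain ⟨w, rfl⟩ := hp
    exact ht.2.1 _ _ hv
  rw [← ncard_strict_prefixes v, ← ncard_sdiff hsub (hfin.subset hsub)]
  congr 1
  ext x
  constructor
  · rintro ⟨⟨hx, hlt⟩, hn⟩
    exact ⟨hx, hlt, fun hp => hn ⟨hp, hlt.ne⟩⟩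
  · rintro ⟨hx, hlt, hn⟩
    exact ⟨⟨hx, hlt⟩, fun hp => hn hp.1⟩

/-- If `u` is not a leaf, the number of vertices in `sideThrough t u` is skipped by
`l ↦ #(sideBefore t l) + 1` on leaves `l`. -/
theorem ncard_sideBefore_add_one_ne {t : Set Vertex} (ht : IsTree t) {u v : Vertex} (hu : u ∈ t)
    (hleaf : ¬ IsLeaf t u) (hv : IsLeaf t v) (hfu : (sideThrough t u).Finite)
    (hfv : (sideBefore t v).Finite) :
    (sideBefore t v).ncard + 1 ≠ (sideThrough t u).ncard := by
  have huv : u ≠ v := by rintro rfl; exact hleaf hv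
  have hjump : sideBefore t v ⊆ sideThrough t u → v ∈ sideThrough t u → u ∉ sideBefore t v →
      (sideBefore t v).ncard + 1 ≠ (sideThrough t u).ncard := by
    intro hsub hvm hum
    have h2 : insert u (insert v (sideBefore t v)) ⊆ sideThrough t u :=
      insert_subset ⟨hu, Or.inr (List.prefix_refl u)⟩ (insert_subset hvm hsub)
    have := ncard_le_ncard h2 hfu
    rw [ncard_insert_of_notMem (by simp [huv, hum]) (hfv.insert v),
      ncard_insert_of_notMem (fun h => lt_irrefl _ h.2.1) hfv] at this
    omega
  by_cases hp : u <+: v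
  · exact hjump (sideBefore_subset_sideThrough_of_prefix t hp) ⟨hv.1, Or.inr hp⟩
      fun h => h.2.2 hp
  · rcases lt_or_gt_of_ne huv with h | h
    · have := ncard_le_ncard (sideThrough_subset_sideBefore t h hp) hfv
      omega
    · exact hjump (sideBefore_subset_sideThrough_of_le t h.le)
        ⟨hv.1, Or.inl ⟨h, fun hvu => huv (hv.eq_of_prefix ht hu hvu)⟩⟩
        fun h' => lt_asymm h h'.2.1

theorem ncard_sideThrough_lt {t : Set Vertex} {u v : Vertex} (hv : v ∈ t) (h : u < v)
    (hp : ¬ u <+: v) (hf : (sideThrough t v).Finite) :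
    (sideThrough t u).ncard < (sideThrough t v).ncard := by
  refine ncard_lt_ncard ⟨(sideThrough_subset_sideBefore t h hp).trans
    (sideBefore_subset_sideThrough_of_le t le_rfl), fun hsub => ?_⟩ hf
  exact lt_irrefl v
    (sideThrough_subset_sideBefore t h hp (hsub ⟨hv, Or.inr (List.prefix_refl v)⟩)).2.1

theorem ncard_lt_lt_ncard_lt {t : Set Vertex} {u v : Vertex} (hu : u ∈ t) (h : u < v)
    (hf : {x ∈ t | x < v}.Finite) : {x ∈ t | x < u}.ncard < {x ∈ t | x < v}.ncard :=
  ncard_lt_ncard ⟨fun _ hx => ⟨hx.1, hx.2.trans h⟩,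
    fun hsub => lt_irrefl u (hsub ⟨hu, h⟩).2⟩ hf

theorem infinite_compl_Aset {t : Set Vertex} {η l : ℕ → Vertex} (ht : IsTree t) (hf : LocFin t)
    (hη : IsSpine t η) (huniq : ∀ η', IsSpine t η' → η' = η)
    (hl : IsEnumOf (leftLeaves t η) l) :
    ({j : ℕ | 1 ≤ j} \ Aset (sVal t l) (leftLeaves t η).encard).Infinite := by
  have hfin := finite_lt_spine ht hf hη huniq
  have hmono : StrictMono fun j => {x ∈ t | x < η j}.ncard := by
    refine strictMono_nat_of_lt_succ fun j => ?_
    obtain ⟨c, hc⟩ := hη.2.2 j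
    refine ncard_lt_lt_ncard_lt (hη.2.1 j) ?_ (hfin _)
    refine (le_of_prefix (hη.prefix_of_le j.le_succ)).lt_of_ne fun h => ?_
    simp [hc] at h
  refine (infinite_range_of_injective (hmono.comp Order.succ_strictMono).injective).mono ?_
  rintro _ ⟨j, rfl⟩
  refine ⟨(Nat.succ_pos j).trans_le (hmono.le_apply (x := j.succ)), ?_⟩
  rintro ⟨i, hi, hs⟩
  obtain ⟨hlt, hleft⟩ := (hl i hi).1
  obtain ⟨k, hk⟩ := hleft.2.2
  rcases lt_trichotomy (l i) (η (j + 1)) with h | h | h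
  · exact (ncard_lt_lt_ncard_lt hlt.1 h (hfin _)).ne hs
  · exact hleft.2.1 _ h.symm
  · exact (ncard_lt_lt_ncard_lt (hη.2.1 _) h
      ((hfin k).subset fun _ hx => ⟨hx.1, hx.2.trans hk⟩)).ne' hs

theorem infinite_compl_Bset {t : Set Vertex} {η l : ℕ → Vertex} (ht : IsTree t) (hf : LocFin t)
    (hspec : SpineSpec t η) (hl : IsEnumOf (leftLeaves t η) l) :
    ({j : ℕ | 1 ≤ j} \ Bset (sVal t l) (pVal l) (leftLeaves t η).encard).Infinite := by
  obtain ⟨hη, huniq, -, -, hinf⟩ := hspec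
  have hfin := finite_lt_spine ht hf hη huniq
  have hfinT : ∀ u, LeftOfSpine t η u → (sideThrough t u).Finite := by
    rintro u ⟨-, hu, j, hj⟩
    exact (hfin j).subset (sideThrough_subset_lt_spine hη hu hj)
  have hinj : InjOn (fun u => (sideThrough t u).ncard)
      {u : Vertex | (∃ k c, u = η k ++ [c]) ∧ LeftOfSpine t η u ∧
        2 ≤ (fringe t u).encard} := by
    have key : ∀ u v : Vertex, (∃ k c, v = η k ++ [c]) → LeftOfSpine t η u →
        LeftOfSpine t η v → u < v → (sideThrough t u).ncard < (sideThrough t v).ncard := by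
      rintro u v ⟨k, c, rfl⟩ hu hv h
      refine ncard_sideThrough_lt hv.1 h (fun hp => ?_) (hfinT _ hv)
      rcases List.prefix_concat_iff.1 hp with rfl | hp
      · exact lt_irrefl _ h
      · exact hu.2.1 _ (hη.eq_of_prefix hp)
    intro u hu v hv huv
    rcases lt_trichotomy u v with h | h | h
    · exact absurd huv (key u v hv.1 hu.2.1 hv.2.1 h).ne
    · exact h
    · exact absurd huv (key v u hu.1 hv.2.1 hu.2.1 h).ne'
  refine (hinf.image hinj).mono ?_
  rintro _ ⟨u, ⟨-, hu, hcard⟩, rfl⟩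
  refine ⟨(ncard_pos (hfinT u hu)).2 ⟨u, hu.1, Or.inr (List.prefix_refl u)⟩, ?_⟩
  rintro ⟨i, hi, hs⟩
  obtain ⟨hleaf, hleft⟩ := (hl i hi).1
  obtain ⟨k, hk⟩ := hleft.2.2
  have hflt : {x ∈ t | x < l i}.Finite :=
    (hfin k).subset fun _ hx => ⟨hx.1, hx.2.trans hk⟩
  rw [sVal, pVal, ncard_lt_sub_length ht hleaf.1 hflt] at hs
  refine ncard_sideBefore_add_one_ne ht hu.1 (fun hul => ?_) hleaf (hfinT u hu)
    (hflt.subset fun _ hx => ⟨hx.1, hx.2.1⟩) hs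
  have : fringe t u ⊆ {u} := fun x hx => hul.eq_of_prefix ht hx.1 hx.2
  have := hcard.trans (encard_le_encard this)
  rw [encard_singleton] at this
  exact absurd this (by norm_num)

theorem existsUnique_strictMono_range_eq {B A : Set ℕ} (hB : B.Infinite) (hA : A.Infinite) :
    ∃! f : ↥B → ℕ, StrictMono f ∧ range f = A := by
  have := hB.to_subtype
  have := hA.to_subtype
  let e : ↥B ≃o ↥A := (Nat.Subtype.orderIsoOfNat B).symm.trans (Nat.Subtype.orderIsoOfNat A)
  refine ⟨fun b => e b, ⟨fun a b h => e.strictMono h, ?_⟩, ?_⟩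
  · have : (fun b => (e b : ℕ)) = Subtype.val ∘ e := rfl
    rw [this, e.surjective.range_comp, Subtype.range_coe]
  · rintro g ⟨hg, hr⟩
    refine (StrictMono.range_inj hg fun a b h => e.strictMono h).1 ?_
    have : (fun b => (e b : ℕ)) = Subtype.val ∘ e := rfl
    rw [hr, this, e.surjective.range_comp, Subtype.range_coe]

/-- For `t ∈ 𝔗_∞` with left-of-spine leaves `l_1 < l_2 < ⋯`,
`s_i = #{v ∈ t : v < l_i}`, `p_i = |l_i|`, there is a unique increasing bijection from
`ℕ ∖ {s_i - p_i + 1 : i ≥ 1}` to `ℕ ∖ {s_i : i ≥ 1}`; in particular both complements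
(within `ℕ = {1, 2, …}`) are infinite. -/
theorem unique_increasing_bijection (t : Set Vertex) (η : ℕ → Vertex)
    (h1 : IsTree t) (h2 : LocFin t) (h3 : t.Infinite) (h4 : SpineSpec t η)
    (l : ℕ → Vertex) (hl : IsEnumOf (leftLeaves t η) l) :
    ({j : ℕ | 1 ≤ j} \ Bset (sVal t l) (pVal l) (leftLeaves t η).encard).Infinite ∧
    ({j : ℕ | 1 ≤ j} \ Aset (sVal t l) (leftLeaves t η).encard).Infinite ∧
    ∃! f : ↥({j : ℕ | 1 ≤ j} \ Bset (sVal t l) (pVal l) (leftLeaves t η).encard) → ℕ,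
      StrictMono f ∧
        Set.range f = {j : ℕ | 1 ≤ j} \ Aset (sVal t l) (leftLeaves t η).encard := by
  have hB := infinite_compl_Bset h1 h2 h4 hl
  have hA := infinite_compl_Aset h1 h2 h4.1 h4.2.1 hl
  exact ⟨hB, hA, existsUnique_strictMono_range_eq hB hA⟩

end AvoidPaper
end

section
/- Let t ∈ 𝔗_∞ and s ∈ 𝔗_f. For a tree r, let (v_{r,i}) be the sequence defined by v_{r,0} = ∅ and v_{r,i} = min{v ∈ r : v ∉ {v_{r,0}, …, v_{r,i−1}}} (minimum in lexicographic order), and for finite s let w_{s,i} = v_{s,|s|+1−i}, while for t ∈ 𝔗_∞ let w_{t,0} = max{v ∈ t} and w_{t,i} = max{w ∈ t : w ∉ {w_{t,0}, …, w_{t,i−1}}}. Fix j ≥ 0. (1) If m ≥ 1 + max_{0≤i≤j} |v_{t,i}| and s^[m] = t^[m], then (v_{t,0}, …, v_{t,j}) = (v_{s,0}, …, v_{s,j}). (2) If m ≥ 1 + max_{0≤i≤j} |w_{t,i}| and s^[m] = t^[m], then (w_{t,0}, …, w_{t,j}) = (w_{s,0}, …, w_{s,j}). -/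
open Set Filter MeasureTheory Topology TopologicalSpace
open scoped ENNReal

namespace AvoidPaper

theorem take_le_self (b : Vertex) (m : ℕ) : b.take m ≤ b :=
  not_lt.1 (List.take_prefix m b).le

theorem lt_take_of_lt {a b : Vertex} {m : ℕ} (hab : a < b) (hm : a.length < m) :
    a < b.take m := by
  induction a generalizing b m with
  | nil =>
    cases b with
    | nil => exact absurd hab (lt_irrefl _)
    | cons y b =>
      cases m with
      | zero => simp at hm
      | succ m => simp
  | cons x a ih =>
    cases b with
    | nil => exact absurd hab (by simp)
    | cons y b =>
      cases m with
      | zero => simp at hm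
      | succ m =>
        rw [List.take_succ_cons, List.cons_lt_cons_iff]
        rcases List.cons_lt_cons_iff.1 hab with h | ⟨rfl, h⟩
        · exact Or.inl h
        · exact Or.inr ⟨rfl, ih h (by simpa using hm)⟩

/-- If a strict total order on vertices is compatible with truncation, then the initial terms of
the enumerations of two trees along this order are determined by a common truncation. -/
theorem enum_eq_of_trunc_eq (r : Vertex → Vertex → Prop) [IsStrictTotalOrder Vertex r]
    (hr : ∀ (a b : Vertex) (m : ℕ), r b a → a.length < m → r (b.take m) a)
    {t s : Set Vertex} (ht : t.Infinite) (hs : IsTree s) {v u : ℕ → Vertex}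
    (hv : ∀ i : ℕ, (i : ℕ∞) < t.encard → v i ∈ t ∧ {x ∈ t | r x (v i)} = v '' {k | k < i})
    (hu : ∀ i : ℕ, (i : ℕ∞) < s.encard → u i ∈ s ∧ {x ∈ s | r x (u i)} = u '' {k | k < i})
    {j m : ℕ} (hm : ∀ i ≤ j, (v i).length + 1 ≤ m) (htr : trunc s m = trunc t m) :
    ∀ i ≤ j, v i = u i := by
  have hv' : ∀ i : ℕ, v i ∈ t ∧ {x ∈ t | r x (v i)} = v '' {k | k < i} := fun i =>
    hv i (by simp [ht.encard_eq])
  have hmem : ∀ x : Vertex, x.length ≤ m → (x ∈ s ↔ x ∈ t) := fun x hx => by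
    have h : x ∈ trunc s m ↔ x ∈ trunc t m := by rw [htr]
    simpa [trunc, hx] using h
  have hlt : ∀ k i : ℕ, k < i → r (v k) (v i) := fun k i hki => by
    have h : v k ∈ {x ∈ t | r x (v i)} := (hv' i).2 ▸ mem_image_of_mem v hki
    exact h.2
  have hinj : Function.Injective v := fun a b hab => by
    rcases lt_trichotomy a b with h | h | h
    · exact absurd (hab ▸ hlt a b h) (irrefl (r := r) _)
    · exact h
    · exact absurd (hab ▸ hlt b a h) (irrefl (r := r) _)
  intro i
  induction i using Nat.strong_induction_on with
  | _ i ih =>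
    intro hij
    have hvs : ∀ k ≤ j, v k ∈ s := fun k hk => (hmem _ (by have := hm k hk; omega)).2 (hv' k).1
    have hcard : (i : ℕ∞) < s.encard := by
      have hsub : v '' Set.Iic i ⊆ s := by
        rintro _ ⟨k, hk, rfl⟩
        exact hvs k (le_trans hk hij)
      have h := encard_le_encard hsub
      rw [hinj.encard_image, ← Finset.coe_Iic, encard_coe_eq_coe_finsetCard, Nat.card_Iic] at h
      exact lt_of_lt_of_le (by exact_mod_cast Nat.lt_succ_self i) h
    obtain ⟨hus, hueq⟩ := hu i hcard
    rcases trichotomous_of r (v i) (u i) with h | h | h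
    · obtain ⟨k, hk, hkv⟩ : v i ∈ u '' {k | k < i} := hueq ▸ ⟨hvs i hij, h⟩
      have hk' : k < i := hk
      rw [← ih k hk' (by omega)] at hkv
      exact absurd (hinj hkv) hk'.ne
    · exact h
    · have hx : (u i).take m ∈ t := by
        refine (hmem _ (List.length_take_le _ _)).1 (hs.2.1 _ ((u i).drop m) ?_)
        rwa [List.take_append_drop]
      obtain ⟨k, hk, hkv⟩ : (u i).take m ∈ v '' {k | k < i} :=
        (hv' i).2 ▸ ⟨hx, hr _ _ _ h (hm i hij)⟩
      have hk' : k < i := hk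
      have hlen := hm k (by omega)
      rw [hkv, List.length_take] at hlen
      have htake : (u i).take m = u i := List.take_of_length_le (by omega)
      rw [htake, ih k hk' (by omega)] at hkv
      have hk'' : u k ∈ {x ∈ s | r x (u i)} := hueq ▸ mem_image_of_mem u hk'
      exact absurd (hkv ▸ hk''.2) (irrefl (r := r) _)

/-- Lemma `lem reduction`.  Let `t ∈ 𝔗_∞` and `s ∈ 𝔗_f`, with increasing
lexicographic enumerations `vt, vs` and decreasing lexicographic enumerations `wt, ws`.
If `m ≥ 1 + max_{0 ≤ i ≤ j} |v_{t,i}|` and `s^[m] = t^[m]`, then the first `j+1` terms of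
the increasing enumerations of `s` and `t` agree; similarly for the decreasing
enumerations. -/
theorem lemma_reduction (t s : Set Vertex) (ht : MemTinf t) (hs : MemTf s)
    (vt vs wt ws : ℕ → Vertex)
    (hvt : IsLexEnum t vt) (hvs : IsLexEnum s vs)
    (hwt : IsLexCoEnum t wt) (hws : IsLexCoEnum s ws) (j : ℕ) :
    (∀ m : ℕ, (∀ i ≤ j, (vt i).length + 1 ≤ m) → trunc s m = trunc t m →
      ∀ i ≤ j, vt i = vs i) ∧
    (∀ m : ℕ, (∀ i ≤ j, (wt i).length + 1 ≤ m) → trunc s m = trunc t m →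
      ∀ i ≤ j, wt i = ws i) := by
  have h_inf := ht.2.2.1
  exact ⟨fun m hm htr => enum_eq_of_trunc_eq (· < ·)
      (fun a b m hba _ => (take_le_self b m).trans_lt hba) h_inf hs.1 hvt hvs hm htr,
    fun m hm htr => enum_eq_of_trunc_eq (· > ·)
      (fun a b m hba ham => lt_take_of_lt hba ham) h_inf hs.1 hwt hws hm htr⟩
end AvoidPaper
end
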